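/- arXiv:1907.05142 — 3 statements merged into one kernel-verified Lean document; each statement's English description precedes it below -/
import Mathlib

section
/- The function f⁺ is continuous and strictly increasing on (−∞, λ⁺−1], satisfies f⁺(θ) → 0 as θ → −∞ and f⁺(λ⁺−1) = −α⁺·Γ(−β⁺) > 0; consequently f⁺ maps (−∞, λ⁺−1] bijectively onto the interval (0, −α⁺·Γ(−β⁺)]. -/
open Set Filter

/-- The increments of `x ↦ x ^ b`, `0 < b < 1`, over intervals of length one strictly decrease. -/
theorem strictAntiOn_rpow_add_one_sub_rpow {b : ℝ} (hb : 0 < b) (hb' : b < 1) :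
    StrictAntiOn (fun u : ℝ => (u + 1) ^ b - u ^ b) (Set.Ici 0) := by
  intro u hu v hv huv
  rw [Set.mem_Ici] at hu hv
  have hc := (Real.strictConcaveOn_rpow hb hb').2
  have hd : 0 < v + 1 - u := by linarith
  have hsum : 1 / (v + 1 - u) + (v - u) / (v + 1 - u) = 1 := by
    field_simp
    ring
  have h₁ : 0 < 1 / (v + 1 - u) := by positivity
  have h₂ : 0 < (v - u) / (v + 1 - u) := div_pos (by linarith) hd
  have hne : u ≠ v + 1 := by linarith
  have hv1 : v + 1 ∈ Set.Ici (0 : ℝ) := Set.mem_Ici.2 (by linarith)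
  have key₁ := hc hu hv1 hne h₁ h₂ hsum
  have key₂ := hc hu hv1 hne h₂ h₁ (by rw [add_comm, hsum])
  simp only [smul_eq_mul] at key₁ key₂
  have e₁ : 1 / (v + 1 - u) * u + (v - u) / (v + 1 - u) * (v + 1) = v := by
    field_simp
    ring
  have e₂ : (v - u) / (v + 1 - u) * u + 1 / (v + 1 - u) * (v + 1) = u + 1 := by
    field_simp
    ring
  rw [e₁] at key₁
  rw [e₂] at key₂
  have e₃ : ∀ x : ℝ, 1 / (v + 1 - u) * x + (v - u) / (v + 1 - u) * x = x := fun x => by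
    rw [← add_mul, hsum, one_mul]
  have := e₃ (u ^ b)
  have := e₃ ((v + 1) ^ b)
  simp only
  linarith

theorem rpow_add_one_sub_rpow_pos {b u : ℝ} (hb : 0 < b) (hu : 0 ≤ u) :
    0 < (u + 1) ^ b - u ^ b :=
  sub_pos.2 (Real.rpow_lt_rpow hu (lt_add_one u) hb)

theorem rpow_add_one_sub_rpow_le {b u : ℝ} (hb : 0 < b) (hb' : b < 1) (hu : 0 < u) :
    (u + 1) ^ b - u ^ b ≤ b * u ^ (-(1 - b)) := by
  have h := rpow_one_add_le_one_add_mul_self (s := 1 / u) (p := b)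
    (by have : 0 < 1 / u := by positivity
        linarith) hb.le hb'.le
  have e : u + 1 = u * (1 + 1 / u) := by field_simp
  have e' : u ^ (-(1 - b)) = u ^ b / u := by
    rw [neg_sub, Real.rpow_sub_one hu.ne']
  rw [e, Real.mul_rpow hu.le (by positivity), e']
  have h' := mul_le_mul_of_nonneg_left h (Real.rpow_nonneg hu.le b)
  calc _ ≤ u ^ b * (1 + b * (1 / u)) - u ^ b := by linarith
    _ = _ := by ring

theorem tendsto_rpow_add_one_sub_rpow {b : ℝ} (hb : 0 < b) (hb' : b < 1) :
    Tendsto (fun u : ℝ => (u + 1) ^ b - u ^ b) atTop (nhds 0) := by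
  have h : Tendsto (fun u : ℝ => b * u ^ (-(1 - b))) atTop (nhds 0) := by
    simpa using (tendsto_rpow_neg_atTop (sub_pos.2 hb')).const_mul b
  refine tendsto_of_tendsto_of_tendsto_of_le_of_le' tendsto_const_nhds h ?_ ?_
  · filter_upwards [eventually_ge_atTop 0] with u hu
    exact (rpow_add_one_sub_rpow_pos hb hu).le
  · filter_upwards [eventually_gt_atTop 0] with u hu
    exact rpow_add_one_sub_rpow_le hb hb' hu

theorem Real.Gamma_neg_lt_zero {b : ℝ} (hb : 0 < b) (hb' : b < 1) : Real.Gamma (-b) < 0 := by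
  have h := Real.Gamma_add_one (neg_ne_zero.2 hb.ne')
  have hpos : 0 < Real.Gamma (-b + 1) := Real.Gamma_pos_of_pos (by linarith)
  rw [h] at hpos
  exact neg_of_mul_pos_right hpos (neg_neg_of_pos hb).le

/-- The function `f⁺(θ) = α⁺Γ(−β⁺)[(λ⁺−θ−1)^{β⁺} − (λ⁺−θ)^{β⁺}]` is continuous
and strictly increasing on `(−∞, λ⁺−1]`, tends to `0` as `θ → −∞`, satisfies
`f⁺(λ⁺−1) = −α⁺Γ(−β⁺) > 0`, and maps `(−∞, λ⁺−1]` bijectively onto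
`(0, −α⁺Γ(−β⁺)]`. -/
theorem bilateral_esscher_fplus_properties
    (ap lp am lm bp bm : ℝ)
    (hap : 0 < ap) (hlp : 0 < lp) (ham : 0 < am) (hlm : 0 < lm)
    (hbp : bp ∈ Set.Ioo (0 : ℝ) 1) (hbm : bm ∈ Set.Ioo (0 : ℝ) 1)
    (fp : ℝ → ℝ)
    (hfp : ∀ θ, fp θ =
      ap * Real.Gamma (-bp) * ((lp - θ - 1) ^ bp - (lp - θ) ^ bp)) :
    ContinuousOn fp (Set.Iic (lp - 1)) ∧
      StrictMonoOn fp (Set.Iic (lp - 1)) ∧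
      Tendsto fp atBot (nhds 0) ∧
      fp (lp - 1) = -(ap * Real.Gamma (-bp)) ∧
      0 < -(ap * Real.Gamma (-bp)) ∧
      Set.BijOn fp (Set.Iic (lp - 1)) (Set.Ioc 0 (-(ap * Real.Gamma (-bp)))) := by
  obtain ⟨hb, hb'⟩ := hbp
  have hC : 0 < -(ap * Real.Gamma (-bp)) :=
    neg_pos.2 (mul_neg_of_pos_of_neg hap (Real.Gamma_neg_lt_zero hb hb'))
  set C := -(ap * Real.Gamma (-bp)) with hCdef
  have hf : ∀ θ, fp θ = C * ((lp - 1 - θ + 1) ^ bp - (lp - 1 - θ) ^ bp) := fun θ => by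
    rw [hfp, hCdef, show lp - 1 - θ + 1 = lp - θ by ring,
      show lp - 1 - θ = lp - θ - 1 by ring]
    ring
  have hcont : Continuous fp := by
    rw [funext hf]
    have h₁ : Continuous fun θ : ℝ => (lp - 1 - θ + 1) ^ bp :=
      (by fun_prop : Continuous fun θ : ℝ => lp - 1 - θ + 1).rpow_const fun _ => Or.inr hb.le
    have h₂ : Continuous fun θ : ℝ => (lp - 1 - θ) ^ bp :=
      (by fun_prop : Continuous fun θ : ℝ => lp - 1 - θ).rpow_const fun _ => Or.inr hb.le
    exact continuous_const.mul (h₁.sub h₂)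
  have hmono : StrictMonoOn fp (Set.Iic (lp - 1)) := by
    intro x hx y hy hxy
    rw [hf, hf]
    exact mul_lt_mul_of_pos_left (strictAntiOn_rpow_add_one_sub_rpow hb hb'
      (Set.mem_Ici.2 (sub_nonneg.2 hy)) (Set.mem_Ici.2 (sub_nonneg.2 hx)) (by linarith)) hC
  have hlim : Tendsto fp atBot (nhds 0) := by
    rw [funext hf]
    have hu : Tendsto (fun θ : ℝ => lp - 1 - θ) atBot atTop :=
      tendsto_atTop_add_const_left _ _ tendsto_neg_atBot_atTop
    simpa using ((tendsto_rpow_add_one_sub_rpow hb hb').comp hu).const_mul C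
  have hend : fp (lp - 1) = C := by
    rw [hf]
    simp [Real.zero_rpow hb.ne']
  refine ⟨hcont.continuousOn, hmono, hlim, hend, hC, fun θ hθ => ⟨?_, ?_⟩, hmono.injOn, ?_⟩
  · rw [hf]
    exact mul_pos hC (rpow_add_one_sub_rpow_pos hb (sub_nonneg.2 hθ))
  · rw [← hend]
    exact hmono.monotoneOn hθ Set.self_mem_Iic hθ
  · rintro y ⟨hy, hyC⟩
    obtain ⟨θ, hθy, hθ⟩ := ((hlim.eventually_lt_const hy).and
      (eventually_le_atBot (lp - 1))).exists
    obtain ⟨x, hx, rfl⟩ := intermediate_value_Icc hθ hcont.continuousOn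
      ⟨hθy.le, hyC.trans_eq hend.symm⟩
    exact ⟨x, hx.2, rfl⟩
end

section
/- Fix real numbers r, q with −α⁺·Γ(−β⁺) ≤ r − q. Then there exists no pair (θ⁺, θ⁻) with θ⁺ ≤ λ⁺−1 and θ⁻ < λ⁻ such that f⁺(θ⁺) + f⁻(θ⁻) = r − q. -/
open Set

theorem Real.Gamma_neg_of_mem_Ioo_zero_one {b : ℝ} (hb : b ∈ Set.Ioo (0 : ℝ) 1) :
    Real.Gamma (-b) < 0 := by
  have hrec := Real.Gamma_add_one (neg_ne_zero.mpr hb.1.ne')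
  have hpos : 0 < Real.Gamma (-b + 1) := Real.Gamma_pos_of_pos (by linarith [hb.2])
  by_contra! h
  nlinarith [mul_nonneg hb.1.le h]

/-- If `−α⁺Γ(−β⁺) ≤ r − q`, then there is no pair `(θ⁺, θ⁻)` with
`θ⁺ ≤ λ⁺−1`, `θ⁻ < λ⁻` and `f⁺(θ⁺) + f⁻(θ⁻) = r − q`, i.e. no bilateral
Esscher transform is a martingale measure. -/
theorem bilateral_esscher_no_martingale_measure
    (ap lp am lm bp bm r q : ℝ)
    (hap : 0 < ap) (hlp : 0 < lp) (ham : 0 < am) (hlm : 0 < lm)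
    (hbp : bp ∈ Set.Ioo (0 : ℝ) 1) (hbm : bm ∈ Set.Ioo (0 : ℝ) 1)
    (hrq : -(ap * Real.Gamma (-bp)) ≤ r - q)
    (fp fm : ℝ → ℝ)
    (hfp : ∀ θ, fp θ =
      ap * Real.Gamma (-bp) * ((lp - θ - 1) ^ bp - (lp - θ) ^ bp))
    (hfm : ∀ θ, fm θ =
      am * Real.Gamma (-bm) * ((lm - θ + 1) ^ bm - (lm - θ) ^ bm)) :
    ¬ ∃ θp θm : ℝ, θp ≤ lp - 1 ∧ θm < lm ∧ fp θp + fm θm = r - q := by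
  rintro ⟨θp, θm, hp, hm, h⟩
  rw [hfp, hfm] at h
  have hGp := mul_neg_of_pos_of_neg hap (Real.Gamma_neg_of_mem_Ioo_zero_one hbp)
  have hGm := mul_neg_of_pos_of_neg ham (Real.Gamma_neg_of_mem_Ioo_zero_one hbm)
  have hsub : (lp - θp) ^ bp ≤ (lp - θp - 1) ^ bp + 1 := by
    simpa using Real.rpow_add_le_add_rpow (by linarith : 0 ≤ lp - θp - 1) zero_le_one
      hbp.1.le hbp.2.le
  have hlt : (lm - θm) ^ bm < (lm - θm + 1) ^ bm :=
    Real.rpow_lt_rpow (by linarith) (by linarith) hbm.1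
  have hplus := mul_le_mul_of_nonpos_left
    (by linarith : -1 ≤ (lp - θp - 1) ^ bp - (lp - θp) ^ bp) hGp.le
  have hminus := mul_neg_of_neg_of_pos hGm (sub_pos.mpr hlt)
  linarith
end

section
/- Define h⁺(θ) = −α⁺·Γ(−β⁺)·( λ⁺·β⁺·(λ⁺−θ)^{β⁺−1} + (1−β⁺)·(λ⁺−θ)^{β⁺} − (λ⁺)^{β⁺} ) for θ < λ⁺, and h⁻(θ) = −α⁻·Γ(−β⁻)·( λ⁻·β⁻·(λ⁻−θ)^{β⁻−1} + (1−β⁻)·(λ⁻−θ)^{β⁻} − (λ⁻)^{β⁻} ) for θ < λ⁻. Let a ∈ ℝ ∪ {−∞} and b ∈ ℝ with a < b ≤ λ⁺−1, and let Φ : (a,b) → ℝ be continuous with Φ(θ) < λ⁻ for all θ ∈ (a,b), Φ(θ) → −∞ as θ → a from the right, and Φ(θ) → λ⁻ as θ → b from the left. Then the function g(θ) = h⁺(θ) + h⁻(Φ(θ)) attains a global minimum on (a,b), i.e. there exists θ* ∈ (a,b) with g(θ*) ≤ g(θ) for all θ ∈ (a,b). -/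
open Filter Set

open Topology

lemma Real.Gamma_neg_of_mem_Ioo {s : ℝ} (hs : s ∈ Ioo (0 : ℝ) 1) : Real.Gamma (-s) < 0 := by
  have h := Real.Gamma_add_one (s := -s) (neg_ne_zero.mpr hs.1.ne')
  have hpos : 0 < Real.Gamma (-s + 1) := Real.Gamma_pos_of_pos (by linarith [hs.2])
  rw [h] at hpos
  nlinarith [hs.1]

/-- The relative entropy of a one-sided Esscher transform, as a function of the transformed
tempering parameter `x = l - θ`. -/
noncomputable def esscherEntropy (K l s x : ℝ) : ℝ :=
  K * (l * s * x ^ (s - 1) + (1 - s) * x ^ s - l ^ s)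

section esscherEntropy

variable {K l s : ℝ}

lemma esscherEntropy_lower_bound (hK : 0 < K) (hl : 0 < l) (hs : s ∈ Ioo (0 : ℝ) 1) {x : ℝ}
    (hx : 0 < x) : -(K * l ^ s) ≤ esscherEntropy K l s x := by
  have h1 : 0 ≤ l * s * x ^ (s - 1) :=
    mul_nonneg (mul_nonneg hl.le hs.1.le) (Real.rpow_nonneg hx.le _)
  have h2 : 0 ≤ (1 - s) * x ^ s :=
    mul_nonneg (by linarith [hs.2]) (Real.rpow_nonneg hx.le _)
  rw [esscherEntropy, ← mul_neg]
  exact mul_le_mul_of_nonneg_left (by linarith) hK.le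

lemma continuousOn_esscherEntropy : ContinuousOn (esscherEntropy K l s) (Ioi 0) := by
  have h (p : ℝ) : ContinuousOn (fun x : ℝ => x ^ p) (Ioi 0) :=
    continuousOn_id.rpow_const fun x hx => Or.inl (ne_of_gt hx)
  exact continuousOn_const.mul
    (((continuousOn_const.mul (h _)).add (continuousOn_const.mul (h _))).sub continuousOn_const)

lemma tendsto_esscherEntropy_nhdsGT_zero (hK : 0 < K) (hl : 0 < l) (hs : s ∈ Ioo (0 : ℝ) 1) :
    Tendsto (esscherEntropy K l s) (𝓝[>] 0) atTop := by
  have h : Tendsto (fun x : ℝ => K * (l * s * x ^ (s - 1) + -l ^ s)) (𝓝[>] 0) atTop :=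
    (tendsto_atTop_add_const_right _ _ ((tendsto_rpow_neg_nhdsGT_zero
      (by linarith [hs.2])).const_mul_atTop (mul_pos hl hs.1))).const_mul_atTop hK
  refine tendsto_atTop_mono' _ ?_ h
  filter_upwards [self_mem_nhdsWithin] with x hx
  have h2 : 0 ≤ (1 - s) * x ^ s :=
    mul_nonneg (by linarith [hs.2]) (Real.rpow_nonneg (le_of_lt hx) _)
  exact mul_le_mul_of_nonneg_left (by linarith) hK.le

lemma tendsto_esscherEntropy_atTop (hK : 0 < K) (hl : 0 < l) (hs : s ∈ Ioo (0 : ℝ) 1) :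
    Tendsto (esscherEntropy K l s) atTop atTop := by
  have h : Tendsto (fun x : ℝ => K * ((1 - s) * x ^ s + -l ^ s)) atTop atTop :=
    (tendsto_atTop_add_const_right _ _ ((tendsto_rpow_atTop hs.1).const_mul_atTop
      (by linarith [hs.2]))).const_mul_atTop hK
  refine tendsto_atTop_mono' _ ?_ h
  filter_upwards [eventually_gt_atTop 0] with x hx
  have h1 : 0 ≤ l * s * x ^ (s - 1) :=
    mul_nonneg (mul_nonneg hl.le hs.1.le) (Real.rpow_nonneg hx.le _)
  exact mul_le_mul_of_nonneg_left (by linarith) hK.le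

end esscherEntropy

/-- A continuous function on an open interval `(a, b)`, with `a` possibly infinite, which tends to
`+∞` at both endpoints attains its minimum. -/
lemma exists_forall_le_of_tendsto_atTop_endpoints {g : ℝ → ℝ} {a : EReal} {b : ℝ}
    (hab : a < (b : EReal)) (hg : ContinuousOn g {θ : ℝ | a < (θ : EReal) ∧ θ < b})
    (hga : Tendsto g (comap (fun x : ℝ => (x : EReal)) (𝓝[>] a)) atTop)
    (hgb : Tendsto g (𝓝[<] b) atTop) :
    ∃ x ∈ {θ : ℝ | a < (θ : EReal) ∧ θ < b},
      ∀ y ∈ {θ : ℝ | a < (θ : EReal) ∧ θ < b}, g x ≤ g y := by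
  obtain ⟨c, hac, hcb⟩ := EReal.lt_iff_exists_real_btwn.mp hab
  obtain ⟨t, ht, hta⟩ := mem_comap.mp (hga.eventually_ge_atTop (g c))
  obtain ⟨u, hu, hut⟩ := (mem_nhdsGT_iff_exists_Ioo_subset' hac).mp ht
  obtain ⟨v, hv, hvb⟩ := (mem_nhdsLT_iff_exists_Ioo_subset' (EReal.coe_lt_coe_iff.mp hcb)).mp
    (hgb.eventually_ge_atTop (g c))
  obtain ⟨p, hap, hpu⟩ := EReal.lt_iff_exists_real_btwn.mp (lt_min hu hac)
  obtain ⟨q, hvq, hqb⟩ := exists_between (max_lt hv (EReal.coe_lt_coe_iff.mp hcb))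
  have hpc : p < c := EReal.coe_lt_coe_iff.mp (hpu.trans_le (min_le_right _ _))
  have hcq : c < q := (le_max_right _ _).trans_lt hvq
  have hsub : Icc p q ⊆ {θ : ℝ | a < (θ : EReal) ∧ θ < b} := fun x hx =>
    ⟨hap.trans_le (EReal.coe_le_coe_iff.mpr hx.1), hx.2.trans_lt hqb⟩
  obtain ⟨x, hx, hmin⟩ := isCompact_Icc.exists_isMinOn ⟨c, hpc.le, hcq.le⟩ (hg.mono hsub)
  have hxc : g x ≤ g c := hmin ⟨hpc.le, hcq.le⟩
  refine ⟨x, hsub hx, fun y hy => ?_⟩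
  rcases lt_or_ge y p with hyp | hpy
  · exact hxc.trans (hta (hut ⟨hy.1, (EReal.coe_lt_coe_iff.mpr hyp).trans
      (hpu.trans_le (min_le_left _ _))⟩))
  rcases lt_or_ge q y with hqy | hyq
  · exact hxc.trans (hvb ⟨((le_max_left _ _).trans_lt hvq).trans hqy, hy.2⟩)
  · exact hmin ⟨hpy, hyq⟩

/-- Existence of a minimal entropy bilateral Esscher martingale measure: with
`h⁺(θ) = −α⁺Γ(−β⁺)(λ⁺β⁺(λ⁺−θ)^{β⁺−1} + (1−β⁺)(λ⁺−θ)^{β⁺} − (λ⁺)^{β⁺})` and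
`h⁻` analogous, given `a ∈ ℝ ∪ {−∞}`, `b ∈ ℝ` with `a < b ≤ λ⁺−1`, and a
continuous function `Φ` on `(a,b)` with values `< λ⁻`, `Φ(θ) → −∞` as
`θ → a⁺` and `Φ(θ) → λ⁻` as `θ → b⁻`, the function
`g(θ) = h⁺(θ) + h⁻(Φ(θ))` attains a global minimum on `(a,b)`. -/
theorem minimal_entropy_bilateral_esscher_exists
    (ap lp am lm bp bm : ℝ)
    (hap : 0 < ap) (hlp : 0 < lp) (ham : 0 < am) (hlm : 0 < lm)
    (hbp : bp ∈ Set.Ioo (0 : ℝ) 1) (hbm : bm ∈ Set.Ioo (0 : ℝ) 1)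
    (hplus hminus : ℝ → ℝ)
    (hhp : ∀ θ, hplus θ = -(ap * Real.Gamma (-bp)) *
      (lp * bp * (lp - θ) ^ (bp - 1) + (1 - bp) * (lp - θ) ^ bp - lp ^ bp))
    (hhm : ∀ θ, hminus θ = -(am * Real.Gamma (-bm)) *
      (lm * bm * (lm - θ) ^ (bm - 1) + (1 - bm) * (lm - θ) ^ bm - lm ^ bm))
    (a : EReal) (b : ℝ) (hab : a < (b : EReal)) (hb : b ≤ lp - 1)
    (S : Set ℝ) (hS : S = {θ : ℝ | a < (θ : EReal) ∧ θ < b})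
    (Phi : ℝ → ℝ)
    (hPhiCont : ContinuousOn Phi S)
    (hPhiLt : ∀ θ ∈ S, Phi θ < lm)
    (hPhia : Tendsto Phi
      (Filter.comap (fun x : ℝ => (x : EReal)) (nhdsWithin a (Set.Ioi a))) atBot)
    (hPhib : Tendsto Phi (nhdsWithin b (Set.Iio b)) (nhds lm)) :
    ∃ θs ∈ S, ∀ θ ∈ S,
      hplus θs + hminus (Phi θs) ≤ hplus θ + hminus (Phi θ) := by
  have hKp : 0 < -(ap * Real.Gamma (-bp)) :=
    neg_pos.mpr (mul_neg_of_pos_of_neg hap (Real.Gamma_neg_of_mem_Ioo hbp))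
  have hKm : 0 < -(am * Real.Gamma (-bm)) :=
    neg_pos.mpr (mul_neg_of_pos_of_neg ham (Real.Gamma_neg_of_mem_Ioo hbm))
  obtain rfl : hplus = fun θ => esscherEntropy (-(ap * Real.Gamma (-bp))) lp bp (lp - θ) :=
    funext hhp
  obtain rfl : hminus = fun θ => esscherEntropy (-(am * Real.Gamma (-bm))) lm bm (lm - θ) :=
    funext hhm
  generalize -(ap * Real.Gamma (-bp)) = Kp at hKp ⊢
  generalize -(am * Real.Gamma (-bm)) = Km at hKm ⊢
  subst hS
  have hbound {θ : ℝ} (hθ : θ < b) : -(Kp * lp ^ bp) ≤ esscherEntropy Kp lp bp (lp - θ) :=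
    esscherEntropy_lower_bound hKp hlp hbp (by linarith)
  have hSb : {θ : ℝ | a < (θ : EReal) ∧ θ < b} ∈ 𝓝[<] b := by
    have h : ∀ᶠ θ : ℝ in 𝓝[<] b, a < (θ : EReal) :=
      (continuous_coe_real_ereal.continuousAt.eventually_const_lt hab).filter_mono
        nhdsWithin_le_nhds
    exact h.and self_mem_nhdsWithin
  refine exists_forall_le_of_tendsto_atTop_endpoints hab ?_ ?_ ?_
  · exact (continuousOn_esscherEntropy.comp (by fun_prop)
        fun θ hθ => mem_Ioi.mpr (by linarith [hθ.2])).add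
      (continuousOn_esscherEntropy.comp (continuousOn_const.sub hPhiCont)
        fun θ hθ => sub_pos.mpr (hPhiLt θ hθ))
  · have hlt : ∀ᶠ θ : ℝ in comap (fun x : ℝ => (x : EReal)) (𝓝[>] a), θ < b := by
      have h : ∀ᶠ x : EReal in 𝓝[>] a, x < b :=
        (eventually_lt_nhds hab).filter_mono nhdsWithin_le_nhds
      exact (h.comap _).mono fun θ hθ => EReal.coe_lt_coe_iff.mp hθ
    refine tendsto_atTop_add_left_of_le' _ (-(Kp * lp ^ bp)) (hlt.mono fun θ => hbound) ?_
    exact (tendsto_esscherEntropy_atTop hKm hlm hbm).comp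
      (tendsto_atTop_add_const_left _ lm (tendsto_neg_atBot_atTop.comp hPhia))
  · refine tendsto_atTop_add_left_of_le' _ (-(Kp * lp ^ bp))
      (mem_of_superset hSb fun θ hθ => hbound hθ.2) ?_
    refine (tendsto_esscherEntropy_nhdsGT_zero hKm hlm hbm).comp
      (tendsto_nhdsWithin_iff.mpr ⟨?_, ?_⟩)
    · simpa using hPhib.const_sub lm
    · exact mem_of_superset hSb fun θ hθ => sub_pos.mpr (hPhiLt θ hθ)
end
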